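/- Assume the CFL condition with some ξ ∈ [0,1), let u0 ∈ L^1(ℝ^d) with 0 ≤ u0 ≤ 1 almost everywhere, let u(x,s) := u0(X(x,s)) be the exact solution, and let t = (N+1)δt for some N ∈ ℕ. Then 𝓔_h(u0,t) ≤ 2 ‖u_h(·,t) − u(·,t)‖_{L^1(ℝ^d)}. -/

import Mathlib

open MeasureTheory Measure Set
open scoped ENNReal NNReal InnerProductSpace Topology

noncomputable section

/-- `d`-dimensional Euclidean space `ℝ^d`. -/
abbrev Euc (d : ℕ) : Type := EuclideanSpace ℝ (Fin d)

/-- `V(·,t)` is divergence-free in the sense of distributions for every `t ≥ 0`. -/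
def DivFree (d : ℕ) (V : Euc d → ℝ → Euc d) : Prop :=
  ∀ t : ℝ, 0 ≤ t → ∀ ψ : Euc d → ℝ, ContDiff ℝ (⊤ : ℕ∞) ψ → HasCompactSupport ψ →
    ∫ x : Euc d, fderiv ℝ ψ x (V x t) = 0

/-- An (unstructured) mesh of `ℝ^d` made of closed connected polygonal control volumes with
disjoint interiors, interfaces contained in hyperplanes, cell diameters at most `h`,
volume of cells at least `α h^d` and perimeter at most `α⁻¹ h^(d-1)`.  `nrm K L` is the unit
normal to the interface `K ∩ L` pointing from `K` towards `L`. -/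
structure Mesh (d : ℕ) (cells : Set (Set (Euc d)))
    (nrm : Set (Euc d) → Set (Euc d) → Euc d) (h α : ℝ) : Prop where
  h_pos : 0 < h
  α_pos : 0 < α
  closed : ∀ K ∈ cells, IsClosed K
  connected : ∀ K ∈ cells, IsConnected K
  disjoint_interiors : ∀ K ∈ cells, ∀ L ∈ cells, K ≠ L → interior K ∩ interior L = ∅
  cover : ⋃₀ cells = univ
  diam_le : ∀ K ∈ cells, Metric.diam K ≤ h
  volume_lb : ∀ K ∈ cells, α * h ^ d ≤ (volume K).toReal
  perimeter_ub : ∀ K ∈ cells, μH[(d : ℝ) - 1] (frontier K) ≤ ENNReal.ofReal (α⁻¹ * h ^ (d - 1))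
  interface_hyperplane : ∀ K ∈ cells, ∀ L ∈ cells, K ≠ L →
    ∃ c : ℝ, K ∩ L ⊆ {x : Euc d | ⟪nrm K L, x⟫_ℝ = c}
  interface_subset_frontier : ∀ K ∈ cells, ∀ L ∈ cells, K ≠ L → K ∩ L ⊆ frontier K
  interfaces_ae_disjoint : ∀ K ∈ cells, ∀ L ∈ cells, ∀ M ∈ cells, K ≠ L → K ≠ M → L ≠ M →
    μH[(d : ℝ) - 1] (K ∩ L ∩ M) = 0
  nrm_unit : ∀ K ∈ cells, ∀ L ∈ cells, K ≠ L → μH[(d : ℝ) - 1] (K ∩ L) ≠ 0 → ‖nrm K L‖ = 1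
  nrm_antisymm : ∀ K ∈ cells, ∀ L ∈ cells, K ≠ L → nrm L K = -nrm K L
  nrm_outward : ∀ K ∈ cells, ∀ L ∈ cells, K ≠ L →
    ∀ᵐ x ∂(μH[(d : ℝ) - 1] |>.restrict (K ∩ L)), ∃ ε > 0, ∀ δ : ℝ, 0 < δ → δ < ε →
      x + δ • nrm K L ∈ L ∧ x - δ • nrm K L ∈ K
  neighbours_finite : ∀ K ∈ cells,
    {L | L ∈ cells ∧ L ≠ K ∧ μH[(d : ℝ) - 1] (K ∩ L) ≠ 0}.Finite

/-- The neighbours of `K`: cells whose common interface with `K` has positive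
`(d-1)`-dimensional Hausdorff measure. -/
def nbr (d : ℕ) (cells : Set (Set (Euc d))) (K : Set (Euc d)) : Set (Set (Euc d)) :=
  {L | L ∈ cells ∧ L ≠ K ∧ μH[(d : ℝ) - 1] (K ∩ L) ≠ 0}

/-- The flux `V_KL^n` of the time-averaged field through the interface `K ∩ L`. -/
def flux (d : ℕ) (V : Euc d → ℝ → Euc d) (nrm : Set (Euc d) → Set (Euc d) → Euc d)
    (δt : ℝ) (K L : Set (Euc d)) (n : ℕ) : ℝ :=
  ∫ x in K ∩ L, ⟪δt⁻¹ • (∫ s in ((n : ℝ) * δt)..(((n : ℝ) + 1) * δt), V x s), nrm K L⟫_ℝ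
    ∂(μH[(d : ℝ) - 1])

/-- `∂K_n^-`: the inflow neighbours of `K` at time level `n`. -/
def negnbr (d : ℕ) (cells : Set (Set (Euc d))) (V : Euc d → ℝ → Euc d)
    (nrm : Set (Euc d) → Set (Euc d) → Euc d) (δt : ℝ) (K : Set (Euc d)) (n : ℕ) :
    Set (Set (Euc d)) :=
  {L | L ∈ nbr d cells K ∧ flux d V nrm δt K L n < 0}

/-- The Courant–Friedrichs–Levy condition with parameter `ξ`. -/
def CFL (d : ℕ) (cells : Set (Set (Euc d))) (V : Euc d → ℝ → Euc d)
    (nrm : Set (Euc d) → Set (Euc d) → Euc d) (δt ξ : ℝ) : Prop :=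
  ∀ K ∈ cells, ∀ n : ℕ,
    ∑ᶠ L ∈ negnbr d cells V nrm δt K n, δt * |flux d V nrm δt K L n| ≤
      (1 - ξ) * (volume K).toReal

/-- `uK` is the family of cell values produced by the explicit upwind finite volume scheme
with initial datum `u0`. -/
def IsScheme (d : ℕ) (cells : Set (Set (Euc d))) (V : Euc d → ℝ → Euc d)
    (nrm : Set (Euc d) → Set (Euc d) → Euc d) (δt : ℝ) (u0 : Euc d → ℝ)
    (uK : ℕ → Set (Euc d) → ℝ) : Prop :=
  (∀ K ∈ cells, uK 0 K = ((volume K).toReal)⁻¹ * ∫ x in K, u0 x) ∧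
  ∀ n : ℕ, ∀ K ∈ cells, uK (n + 1) K = uK n K -
    (δt / (volume K).toReal) *
      ∑ᶠ L ∈ negnbr d cells V nrm δt K n, flux d V nrm δt K L n * (uK n L - uK n K)

/-- `uh` is the piecewise constant function built from the cell values `uK`. -/
def IsUh (d : ℕ) (cells : Set (Set (Euc d))) (δt : ℝ) (uK : ℕ → Set (Euc d) → ℝ)
    (uh : Euc d → ℝ → ℝ) : Prop :=
  ∀ n : ℕ, ∀ K ∈ cells, ∀ x ∈ interior K,
    ∀ t ∈ Ico ((n : ℝ) * δt) (((n : ℝ) + 1) * δt), uh x t = uK n K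

/-- First order expansion of the determinant at the identity, with a quadratic remainder. -/
lemma exists_abs_det_one_add_sub_le (d : ℕ) : ∃ δ > 0, ∃ C : ℝ, 0 ≤ C ∧
    ∀ B : Euc d →L[ℝ] Euc d, ‖B‖ < δ → LinearMap.trace ℝ (Euc d) B = 0 →
      |(1 + B).det - 1| ≤ C * ‖B‖ ^ 2 := by
  let b := (EuclideanSpace.basisFun (Fin d) ℝ).toBasis
  have hdet (A : Euc d →L[ℝ] Euc d) : A.det =
      (LinearMap.toMatrix b b (A : Euc d →ₗ[ℝ] Euc d)).det := (LinearMap.det_toMatrix b _).symm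
  let f : (Euc d →L[ℝ] Euc d) → ℝ := fun B => (1 + B).det
  have hf : ContDiff ℝ 2 f := by
    have : f = fun B => ∑ σ : Equiv.Perm (Fin d), (Equiv.Perm.sign σ : ℤ) *
        ∏ i, ((1 + B : Euc d →L[ℝ] Euc d) (EuclideanSpace.single i 1)) (σ i) := by
      ext B
      simp only [f, hdet, Matrix.det_apply']
      simp [LinearMap.toMatrix_apply, b]
    rw [this]
    refine ContDiff.sum fun σ _ => contDiff_const.mul (contDiff_prod fun i _ => ?_)
    have h1 : ContDiff ℝ 2 fun B : Euc d →L[ℝ] Euc d =>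
        (1 + B : Euc d →L[ℝ] Euc d) (EuclideanSpace.single i (1 : ℝ)) :=
      (contDiff_const.add contDiff_id).clm_apply contDiff_const
    exact (EuclideanSpace.proj (𝕜 := ℝ) (σ i)).contDiff.comp h1
  have hderiv (B : Euc d →L[ℝ] Euc d) (hB : LinearMap.trace ℝ (Euc d) B = 0) :
      fderiv ℝ f 0 B = 0 := by
    have h1 : HasDerivAt (fun r : ℝ => f (r • B)) (fderiv ℝ f 0 B) 0 := by
      have h2 : HasDerivAt (fun r : ℝ => r • B) B 0 := by
        simpa using (hasDerivAt_id (0 : ℝ)).smul_const B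
      have h3 : HasFDerivAt f (fderiv ℝ f 0) ((0 : ℝ) • B) := by
        have h0 : (0 : ℝ) • B = 0 := zero_smul ℝ B
        rw [h0]
        exact (hf.differentiable (by norm_num) 0).hasFDerivAt
      exact h3.comp_hasDerivAt 0 h2
    set M := LinearMap.toMatrix b b (B : Euc d →ₗ[ℝ] Euc d)
    set p := (Matrix.det (1 + (Polynomial.X : Polynomial ℝ) • M.map Polynomial.C)).divX.divX
    have h2 : (fun r : ℝ => f (r • B)) = fun r => 1 + p.eval r * r ^ 2 := by
      ext r
      have := Matrix.det_one_add_smul r M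
      have ht : M.trace = 0 := by rw [← hB]; exact (LinearMap.trace_eq_matrix_trace ℝ b _).symm
      rw [ht] at this
      simp only [f, hdet]
      simpa [M] using this
    have h3 : HasDerivAt (fun r : ℝ => 1 + p.eval r * r ^ 2) 0 0 := by
      have := ((p.hasDerivAt 0).mul (hasDerivAt_pow 2 (0 : ℝ))).const_add 1
      simpa using this
    rw [h2] at h1
    exact h1.unique h3
  have hf' : ContDiff ℝ 1 (fderiv ℝ f) := hf.fderiv_right (by norm_num)
  obtain ⟨K, t, ht, hK⟩ := (hf'.contDiffAt (x := 0)).exists_lipschitzOnWith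
  obtain ⟨δ, hδ, hδt⟩ := Metric.mem_nhds_iff.1 ht
  refine ⟨δ, hδ, K, K.2, fun B hB hBt => ?_⟩
  have hsub : Metric.closedBall (0 : Euc d →L[ℝ] Euc d) ‖B‖ ⊆ t :=
    (Metric.closedBall_subset_ball hB).trans hδt
  have := (convex_closedBall (0 : Euc d →L[ℝ] Euc d) ‖B‖).norm_image_sub_le_of_norm_fderiv_le'
    (𝕜 := ℝ) (f := f) (φ := fderiv ℝ f 0) (C := K * ‖B‖) (x := 0) (y := B)
    (fun x _ => hf.differentiable (by norm_num) x) (fun x hx => by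
      have h1 := hK.norm_sub_le (hsub hx) (hsub (Metric.mem_closedBall_self (norm_nonneg _)))
      rw [sub_zero] at h1
      rw [mem_closedBall_zero_iff] at hx
      exact h1.trans (by gcongr)) (Metric.mem_closedBall_self (norm_nonneg _))
      (by simp)
  rw [sub_zero, hderiv B hBt, sub_zero, Real.norm_eq_abs] at this
  have h1 : f 0 = 1 := by simp [f, ContinuousLinearMap.det]
  rwa [h1, mul_assoc, ← pow_two] at this

/-- A Lipschitz field that is divergence-free in the sense of distributions has a trace-free
derivative almost everywhere. -/
lemma ae_trace_fderiv_eq_zero {d : ℕ} {W : Euc d → Euc d} {L : ℝ≥0} (hW : LipschitzWith L W)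
    (hdiv : ∀ ψ : Euc d → ℝ, ContDiff ℝ (⊤ : ℕ∞) ψ → HasCompactSupport ψ →
      ∫ x : Euc d, fderiv ℝ ψ x (W x) = 0) :
    ∀ᵐ x, LinearMap.trace ℝ (Euc d) (fderiv ℝ W x) = 0 := by
  have hWi (i : Fin d) : LipschitzWith L (fun x => W x i) := by
    refine LipschitzWith.of_dist_le_mul fun x y => ?_
    refine le_trans ?_ (hW.dist_le_mul x y)
    rw [dist_eq_norm, dist_eq_norm]
    exact PiLp.norm_apply_le (W x - W y) i
  let e (i : Fin d) : Euc d := EuclideanSpace.single i 1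
  have hsum : ∀ᵐ x, ∑ i, lineDeriv ℝ (fun y => W y i) x (e i) = 0 := by
    refine ae_eq_zero_of_integral_contDiff_smul_eq_zero
      (locallyIntegrable_finsetSum _ fun i _ => (hWi i).locallyIntegrable_lineDeriv (e i))
      fun g hg hgc => ?_
    have hg1 : ContDiff ℝ 1 g := hg.of_le (by exact_mod_cast le_top)
    obtain ⟨D, hD⟩ : ∃ D, LipschitzWith D g :=
      ContDiff.lipschitzWith_of_hasCompactSupport hgc hg1 (by simp)
    have hint (i : Fin d) : Integrable fun x => g x • lineDeriv ℝ (fun y => W y i) x (e i) :=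
      (hg.continuous.integrable_of_hasCompactSupport hgc).smul_of_top_left
        ((hWi i).memLp_lineDeriv (e i))
    have hint2 (i : Fin d) : Integrable fun x => fderiv ℝ g x (e i) * W x i := by
      refine Continuous.integrable_of_hasCompactSupport ?_ ?_
      · exact ((hg1.continuous_fderiv (by simp)).clm_apply continuous_const).mul
          (hWi i).continuous
      · refine HasCompactSupport.mul_right ?_
        exact (hgc.fderiv (𝕜 := ℝ)).comp_left (g := fun A : Euc d →L[ℝ] ℝ => A (e i)) rfl
    have hparts (i : Fin d) : ∫ x, g x • lineDeriv ℝ (fun y => W y i) x (e i) =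
        - ∫ x, fderiv ℝ g x (e i) * W x i := by
      have := LipschitzWith.integral_lineDeriv_mul_eq (μ := volume) (hWi i) hD hgc (e i)
      simp_rw [smul_eq_mul, mul_comm (g _)]
      rw [this, ← integral_neg]
      congr 1 with x
      rw [(hg1.differentiable (by simp)).differentiableAt.lineDeriv_eq_fderiv]
      simp
    simp_rw [Finset.smul_sum]
    rw [integral_finsetSum _ fun i _ => hint i]
    simp_rw [hparts]
    rw [Finset.sum_neg_distrib, ← integral_finsetSum _ fun i _ => hint2 i, neg_eq_zero,
      ← hdiv g hg hgc]
    congr 1 with x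
    conv_rhs => rw [← (EuclideanSpace.basisFun (Fin d) ℝ).sum_repr (W x)]
    simp [e, mul_comm]
  filter_upwards [hsum, hW.ae_differentiableAt] with x hx hdx
  rw [LinearMap.trace_eq_matrix_trace ℝ (EuclideanSpace.basisFun (Fin d) ℝ).toBasis, ← hx,
    Matrix.trace]
  refine Finset.sum_congr rfl fun i _ => ?_
  have h1 : HasFDerivAt (fun y => W y i) ((EuclideanSpace.proj (𝕜 := ℝ) i).comp (fderiv ℝ W x)) x :=
    (EuclideanSpace.proj (𝕜 := ℝ) i).hasFDerivAt.comp x hdx.hasFDerivAt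
  rw [h1.differentiableAt.lineDeriv_eq_fderiv, h1.fderiv]
  simp [LinearMap.toMatrix_apply, e]

/-- The explicit Euler step of a divergence-free Lipschitz field contracts volumes by a factor
`1 - O(r²)` at most. -/
lemma volume_preimage_euler_step_le (d : ℕ) (L : ℝ≥0) : ∃ r₀ > 0, ∃ C : ℝ, 0 ≤ C ∧
    ∀ W : Euc d → Euc d, LipschitzWith L W →
    (∀ ψ : Euc d → ℝ, ContDiff ℝ (⊤ : ℕ∞) ψ → HasCompactSupport ψ →
      ∫ x : Euc d, fderiv ℝ ψ x (W x) = 0) →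
    ∀ r : ℝ, 0 ≤ r → r < r₀ → ∀ B : Set (Euc d), MeasurableSet B →
      ENNReal.ofReal (1 - C * r ^ 2) * volume ((fun x => x + r • W x) ⁻¹' B) ≤ volume B := by
  obtain ⟨δ, hδ, C, hC, hdet⟩ := exists_abs_det_one_add_sub_le d
  refine ⟨min (δ / (L + 1)) (1 / (L + 1)), by positivity, C * L ^ 2, by positivity,
    fun W hW hdiv r hr hr0 B hB => ?_⟩
  have hL1 : (0 : ℝ) < L + 1 := by positivity
  have hrδ : r * L < δ := by
    have h1 := (lt_div_iff₀ hL1).1 (hr0.trans_le (min_le_left _ _))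
    nlinarith
  have hr1 : r * L < 1 := by
    have h1 := (lt_div_iff₀ hL1).1 (hr0.trans_le (min_le_right _ _))
    nlinarith
  set Φ : Euc d → Euc d := fun x => x + r • W x
  have hinj : Function.Injective Φ := by
    intro x y hxy
    by_contra hne
    have h1 : x - y = r • (W y - W x) := by
      have : x + r • W x = y + r • W y := hxy
      rw [smul_sub, sub_eq_sub_iff_add_eq_add, this, add_comm]
    have h2 := hW.norm_sub_le y x
    have h3 : ‖x - y‖ = r * ‖W y - W x‖ := by rw [h1, norm_smul, Real.norm_of_nonneg hr]
    have h4 : 0 < ‖x - y‖ := norm_pos_iff.2 (sub_ne_zero.2 hne)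
    rw [norm_sub_rev y x] at h2
    nlinarith [mul_le_mul_of_nonneg_left h2 hr]
  have hΦm : Measurable Φ :=
    (continuous_id.add (hW.continuous.const_smul r)).measurable
  set D := {x | DifferentiableAt ℝ W x}
  have hD : MeasurableSet D := measurableSet_of_differentiableAt ℝ W
  set S := Φ ⁻¹' B ∩ D
  have hS : MeasurableSet S := (hΦm hB).inter hD
  have hvol : volume (Φ ⁻¹' B) = volume S :=
    (measure_inter_conull (show volume Dᶜ = 0 from hW.ae_differentiableAt)).symm
  have hfd : ∀ x ∈ S, HasFDerivWithinAt Φ (1 + r • fderiv ℝ W x) S x := fun x hx =>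
    ((hasFDerivAt_id x).add (hx.2.hasFDerivAt.const_smul r)).hasFDerivWithinAt
  have himg := lintegral_abs_det_fderiv_eq_addHaar_image volume hS hfd hinj.injOn
  calc ENNReal.ofReal (1 - C * L ^ 2 * r ^ 2) * volume (Φ ⁻¹' B)
      = ∫⁻ _ in S, ENNReal.ofReal (1 - C * L ^ 2 * r ^ 2) := by rw [hvol, setLIntegral_const]
    _ ≤ ∫⁻ x in S, ENNReal.ofReal |(1 + r • fderiv ℝ W x).det| := by
        refine lintegral_mono_ae ?_
        filter_upwards [ae_restrict_of_ae (ae_trace_fderiv_eq_zero hW hdiv)] with x hx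
        refine ENNReal.ofReal_le_ofReal ?_
        have hn : ‖r • fderiv ℝ W x‖ ≤ r * L := by
          rw [norm_smul, Real.norm_of_nonneg hr]
          gcongr
          exact norm_fderiv_le_of_lipschitz ℝ hW
        have h1 := hdet (r • fderiv ℝ W x) (hn.trans_lt hrδ) (by
          rw [ContinuousLinearMap.toLinearMap_smul, map_smul, hx, smul_zero])
        have h2 : C * ‖r • fderiv ℝ W x‖ ^ 2 ≤ C * (r * L) ^ 2 := by gcongr
        have h3 := (abs_le.1 (h1.trans h2)).1
        calc 1 - C * L ^ 2 * r ^ 2 ≤ (1 + r • fderiv ℝ W x).det := by linarith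
          _ ≤ _ := le_abs_self _
    _ = volume (Φ '' S) := himg
    _ ≤ volume B := measure_mono (by rintro _ ⟨x, hx, rfl⟩; exact hx.1)

/-- The explicit Euler scheme with step `τ` for the field `W`, started at time `0`. -/
def euler {d : ℕ} (W : Euc d → ℝ → Euc d) (τ : ℝ) : ℕ → Euc d → Euc d
  | 0, x => x
  | k + 1, x => euler W τ k x + τ • W (euler W τ k x) (k * τ)

lemma measurable_euler {d : ℕ} {W : Euc d → ℝ → Euc d} (hW : ∀ t, Continuous fun x => W x t)
    (τ : ℝ) (k : ℕ) : Measurable (euler W τ k) := by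
  induction k with
  | zero => exact measurable_id
  | succ k ih => exact ih.add (((hW _).measurable.comp ih).const_smul τ)

lemma volume_preimage_euler_le (d : ℕ) (L : ℝ≥0) : ∃ r₀ > 0, ∃ C : ℝ, 0 ≤ C ∧
    ∀ (W : Euc d → ℝ → Euc d) (T : ℝ), (∀ t, LipschitzWith L fun x => W x t) →
    (∀ t ∈ Icc 0 T, ∀ ψ : Euc d → ℝ, ContDiff ℝ (⊤ : ℕ∞) ψ → HasCompactSupport ψ →
      ∫ x : Euc d, fderiv ℝ ψ x (W x t) = 0) →
    ∀ τ : ℝ, 0 ≤ τ → τ < r₀ → ∀ k : ℕ, k * τ ≤ T → ∀ B : Set (Euc d), MeasurableSet B →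
      ENNReal.ofReal (1 - C * τ ^ 2) ^ k * volume (euler W τ k ⁻¹' B) ≤ volume B := by
  obtain ⟨r₀, hr₀, C, hC, hstep⟩ := volume_preimage_euler_step_le d L
  refine ⟨r₀, hr₀, C, hC, fun W T hW hdiv τ hτ hτr k => ?_⟩
  induction k with
  | zero => intro _ B _; simp [euler]
  | succ k ih =>
    intro hk B hB
    have hk' : (k : ℝ) * τ ≤ T := by push_cast at hk; nlinarith
    set Φ : Euc d → Euc d := fun x => x + τ • W x (k * τ)
    have hΦ : Measurable Φ :=
      (continuous_id.add ((hW (k * τ)).continuous.const_smul τ)).measurable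
    have hpre : euler W τ (k + 1) ⁻¹' B = euler W τ k ⁻¹' (Φ ⁻¹' B) := rfl
    rw [hpre, pow_succ', mul_assoc]
    refine le_trans ?_ (hstep _ (hW (k * τ)) (hdiv _ ⟨by positivity, hk'⟩) τ hτ hτr B hB)
    gcongr
    exact ih hk' _ (hΦ hB)

/-- Convergence of the explicit Euler scheme for a bounded Lipschitz field. -/
lemma norm_euler_sub_le {d : ℕ} {W : Euc d → ℝ → Euc d} {C : ℝ} {L : ℝ≥0} {T : ℝ}
    (hbdd : ∀ x t, ‖W x t‖ ≤ C) (hlip : LipschitzWith L fun p : Euc d × ℝ => W p.1 p.2)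
    {z : ℝ → Euc d} (hz : ∀ t ∈ Icc 0 T, HasDerivWithinAt z (W (z t) t) (Icc 0 T) t)
    {τ : ℝ} (hτ : 0 ≤ τ) (k : ℕ) (hk : k * τ ≤ T) :
    ‖euler W τ k (z 0) - z (k * τ)‖ ≤ k * (L * (C + 1) * τ ^ 2) * (1 + L * τ) ^ k := by
  have hC : 0 ≤ C := (norm_nonneg _).trans (hbdd (z 0) 0)
  induction k with
  | zero => simp [euler]
  | succ k ih =>
    have hkτ : (0 : ℝ) ≤ k * τ := by positivity
    push_cast at hk ⊢
    have hk' : (k : ℝ) * τ ≤ T := by nlinarith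
    have hle : (k : ℝ) * τ ≤ (k + 1) * τ := by nlinarith
    specialize ih hk'
    set a := (k : ℝ) * τ
    set b := ((k : ℝ) + 1) * τ
    have hab : b - a = τ := by simp only [a, b]; ring
    have hsub : Icc a b ⊆ Icc 0 T := Icc_subset_Icc hkτ hk
    have hzl (s) (hs : s ∈ Icc a b) : ‖z s - z a‖ ≤ C * τ := by
      have := (convex_Icc (0 : ℝ) T).norm_image_sub_le_of_norm_hasDerivWithin_le hz
        (fun t _ => hbdd (z t) t) (hsub (left_mem_Icc.2 hle)) (hsub hs)
      refine this.trans ?_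
      rw [Real.norm_of_nonneg (sub_nonneg.2 hs.1)]
      gcongr
      linarith [hs.2]
    have hloc : ‖z b - z a - τ • W (z a) a‖ ≤ L * (C + 1) * τ ^ 2 := by
      have := (convex_Icc a b).norm_image_sub_le_of_norm_hasDerivWithin_le
        (f := fun s => z s - s • W (z a) a) (f' := fun s => W (z s) s - W (z a) a)
        (C := L * (C + 1) * τ) (x := a) (y := b) (fun s hs => by
          have h1 := ((hz s (hsub hs)).mono hsub).sub
            ((hasDerivWithinAt_id s (Icc a b)).smul_const (W (z a) a))
          rw [one_smul] at h1
          exact h1)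
        (fun s hs => by
          have h1 := hlip.norm_sub_le (z s, s) (z a, a)
          refine h1.trans ?_
          rw [mul_assoc]
          gcongr
          rw [Prod.norm_def]
          refine max_le ?_ ?_
          · exact (hzl s hs).trans (by nlinarith)
          · simp only [Prod.snd_sub]
            rw [Real.norm_of_nonneg (sub_nonneg.2 hs.1)]
            nlinarith [hs.2, mul_nonneg hC hτ])
        (left_mem_Icc.2 hle) (right_mem_Icc.2 hle)
      rw [hab, Real.norm_of_nonneg hτ] at this
      calc ‖z b - z a - τ • W (z a) a‖ = ‖z b - b • W (z a) a - (z a - a • W (z a) a)‖ := by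
            rw [← hab, sub_smul]; congr 1; abel
        _ ≤ _ := this
        _ = _ := by ring
    set E := euler W τ k (z 0)
    have hEW : ‖W E a - W (z a) a‖ ≤ L * ‖E - z a‖ := by
      have h1 := hlip.norm_sub_le (E, a) (z a, a)
      simpa [Prod.norm_def] using h1
    set M := (L : ℝ) * (C + 1) * τ ^ 2
    have hM : 0 ≤ M := by positivity
    have hone : 1 ≤ (1 + (L : ℝ) * τ) ^ (k + 1) := one_le_pow₀ (by nlinarith [L.2, mul_nonneg L.2 hτ])
    calc ‖euler W τ (k + 1) (z 0) - z b‖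
        = ‖(E - z a) + τ • (W E a - W (z a) a) - (z b - z a - τ • W (z a) a)‖ := by
          congr 1
          change E + τ • W E a - z b = _
          rw [smul_sub]; abel
      _ ≤ ‖E - z a‖ + τ * (L * ‖E - z a‖) + M := by
          refine (norm_sub_le _ _).trans (add_le_add ((norm_add_le _ _).trans ?_) hloc)
          rw [norm_smul, Real.norm_of_nonneg hτ]
          gcongr
      _ = (1 + L * τ) * ‖E - z a‖ + M := by ring
      _ ≤ (1 + L * τ) * (k * M * (1 + L * τ) ^ k) + M := by gcongr
      _ = k * M * (1 + L * τ) ^ (k + 1) + M * 1 := by ring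
      _ ≤ k * M * (1 + L * τ) ^ (k + 1) + M * (1 + L * τ) ^ (k + 1) := by gcongr
      _ = _ := by ring

lemma tendsto_euler {d : ℕ} {W : Euc d → ℝ → Euc d} {C : ℝ} {L : ℝ≥0} {T : ℝ} (hT : 0 ≤ T)
    (hbdd : ∀ x t, ‖W x t‖ ≤ C) (hlip : LipschitzWith L fun p : Euc d × ℝ => W p.1 p.2)
    {z : ℝ → Euc d} (hz : ∀ t ∈ Icc 0 T, HasDerivWithinAt z (W (z t) t) (Icc 0 T) t) :
    Filter.Tendsto (fun n : ℕ => euler W (T / n) n (z 0)) Filter.atTop (𝓝 (z T)) := by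
  have hC : 0 ≤ C := (norm_nonneg _).trans (hbdd (z 0) 0)
  rw [tendsto_iff_norm_sub_tendsto_zero]
  refine squeeze_zero' (Filter.Eventually.of_forall fun _ => norm_nonneg _) ?_
    (tendsto_const_div_atTop_nhds_zero_nat (L * (C + 1) * T ^ 2 * Real.exp (L * T)))
  filter_upwards [Filter.eventually_gt_atTop 0] with n hn
  have hn' : (0 : ℝ) < n := by exact_mod_cast hn
  have hnT : (n : ℝ) * (T / n) = T := by field_simp
  have h1 := norm_euler_sub_le hbdd hlip hz (τ := T / n) (by positivity) n hnT.le
  rw [hnT] at h1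
  refine h1.trans ?_
  have h2 : (1 + L * (T / n)) ^ n ≤ Real.exp (L * T) := by
    calc (1 + L * (T / n)) ^ n ≤ Real.exp (L * (T / n)) ^ n := by
          gcongr
          linarith [Real.add_one_le_exp ((L : ℝ) * (T / n))]
      _ = Real.exp (L * T) := by
          rw [← Real.exp_nat_mul]; congr 1; field_simp
  calc _ ≤ n * (L * (C + 1) * (T / n) ^ 2) * Real.exp (L * T) := by gcongr
    _ = _ := by field_simp

/-- The time-`T` map of a bounded Lipschitz divergence-free field does not increase volumes. -/
lemma measurable_and_map_volume_le_of_flow {d : ℕ} {W : Euc d → ℝ → Euc d} {C : ℝ} {L : ℝ≥0}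
    {T : ℝ} (hT : 0 ≤ T) (hbdd : ∀ x t, ‖W x t‖ ≤ C)
    (hlip : LipschitzWith L fun p : Euc d × ℝ => W p.1 p.2)
    (hdiv : ∀ t ∈ Icc 0 T, ∀ ψ : Euc d → ℝ, ContDiff ℝ (⊤ : ℕ∞) ψ → HasCompactSupport ψ →
      ∫ x : Euc d, fderiv ℝ ψ x (W x t) = 0)
    {Z : Euc d → ℝ → Euc d} (hZ0 : ∀ x, Z x 0 = x)
    (hZ : ∀ x, ∀ t ∈ Icc 0 T, HasDerivWithinAt (Z x) (W (Z x t) t) (Icc 0 T) t) :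
    Measurable (fun x => Z x T) ∧ (volume : Measure (Euc d)).map (fun x => Z x T) ≤ volume := by
  have hlipx (t) : LipschitzWith L fun x => W x t := by
    refine LipschitzWith.of_dist_le_mul fun x y => ?_
    simpa [Prod.dist_eq] using hlip.dist_le_mul (x, t) (y, t)
  have hlim (x) : Filter.Tendsto (fun n : ℕ => euler W (T / n) n x) Filter.atTop (𝓝 (Z x T)) := by
    simpa [hZ0] using tendsto_euler hT hbdd hlip (hZ x)
  have hmeas (n : ℕ) : Measurable (euler W (T / n) n) :=
    measurable_euler (fun t => (hlipx t).continuous) _ _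
  have hZm : Measurable (fun x => Z x T) :=
    measurable_of_tendsto_metrizable hmeas (tendsto_pi_nhds.2 hlim)
  refine ⟨hZm, ?_⟩
  obtain ⟨r₀, hr₀, K, hK, hvol⟩ := volume_preimage_euler_le d L
  have hopen (U : Set (Euc d)) (hU : IsOpen U) : volume ((fun x => Z x T) ⁻¹' U) ≤ volume U := by
    let c : ℕ → ℝ≥0∞ := fun n => ENNReal.ofReal (1 - K * T ^ 2 / n)
    have hc : Filter.Tendsto c Filter.atTop (𝓝 1) := by
      rw [← ENNReal.ofReal_one]
      refine ENNReal.tendsto_ofReal ?_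
      simpa using (tendsto_const_div_atTop_nhds_zero_nat (K * T ^ 2)).const_sub 1
    have hle : ∀ᶠ n in Filter.atTop, c n * volume (euler W (T / n) n ⁻¹' U) ≤ volume U := by
      have h0 : Filter.Tendsto (fun n : ℕ => T / (n : ℝ)) Filter.atTop (𝓝 0) :=
        tendsto_const_div_atTop_nhds_zero_nat T
      have h1 : Filter.Tendsto (fun n : ℕ => K * (T / (n : ℝ)) ^ 2) Filter.atTop (𝓝 0) := by
        simpa using (h0.pow 2).const_mul K
      filter_upwards [Filter.eventually_gt_atTop 0, h0.eventually_lt_const hr₀,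
        h1.eventually_le_const one_pos] with n hn hnr hn1
      have hn' : (0 : ℝ) < n := by exact_mod_cast hn
      have hnT : (n : ℝ) * (T / n) = T := by field_simp
      refine le_trans ?_ (hvol W T hlipx hdiv (T / n) (by positivity) hnr n hnT.le U
        hU.measurableSet)
      gcongr
      rw [← ENNReal.ofReal_pow (by linarith)]
      refine ENNReal.ofReal_le_ofReal ?_
      have := one_add_mul_le_pow (a := -(K * (T / n) ^ 2)) (by linarith) n
      calc 1 - K * T ^ 2 / n = 1 + n * -(K * (T / n) ^ 2) := by field_simp; ring
        _ ≤ _ := this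
        _ = _ := by ring
    calc volume ((fun x => Z x T) ⁻¹' U)
        = ∫⁻ x, ((fun x => Z x T) ⁻¹' U).indicator 1 x :=
          (lintegral_indicator_one (hZm hU.measurableSet)).symm
      _ ≤ ∫⁻ x, Filter.liminf (fun n =>
            (c n • (euler W (T / n) n ⁻¹' U).indicator 1) x) Filter.atTop := by
          refine lintegral_mono fun x => ?_
          by_cases hx : Z x T ∈ U
          · have h1 : Filter.Tendsto (fun n =>
                (c n • (euler W (T / n) n ⁻¹' U).indicator (1 : Euc d → ℝ≥0∞)) x)
                Filter.atTop (𝓝 1) := by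
              refine hc.congr' ?_
              filter_upwards [(hlim x).eventually_mem (hU.mem_nhds hx)] with n hn
              simp [indicator_of_mem (show x ∈ euler W (T / n) n ⁻¹' U from hn)]
            rw [h1.liminf_eq]
            exact indicator_le_self' (by simp) x
          · rw [indicator_of_notMem (by exact hx)]
            exact zero_le
      _ ≤ Filter.liminf (fun n => ∫⁻ x, (c n • (euler W (T / n) n ⁻¹' U).indicator
            (1 : Euc d → ℝ≥0∞)) x) Filter.atTop :=
          lintegral_liminf_le fun n =>
            (measurable_one.indicator (hmeas n hU.measurableSet)).const_smul (c n)
      _ ≤ volume U := by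
          refine Filter.liminf_le_of_frequently_le' (Filter.Eventually.frequently ?_)
          filter_upwards [hle] with n hn
          refine le_trans (le_of_eq ?_) hn
          simp only [Pi.smul_apply, smul_eq_mul]
          rw [lintegral_const_mul _ (measurable_one.indicator (hmeas n hU.measurableSet)),
            lintegral_indicator_one (hmeas n hU.measurableSet)]
  refine Measure.le_iff.2 fun A hA => ?_
  rw [Measure.map_apply hZm hA, A.measure_eq_iInf_isOpen volume]
  refine le_iInf₂ fun U hAU => le_iInf fun hU => ?_
  exact (measure_mono (preimage_mono hAU)).trans (hopen U hU)

/-- The inverse of the flow of a bounded Lipschitz divergence-free field preserves volume. -/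
lemma measurePreserving_flow_inverse {d : ℕ} {V : Euc d → ℝ → Euc d} {C : ℝ} {L : ℝ≥0}
    (hbdd : ∀ x t, ‖V x t‖ ≤ C) (hlip : LipschitzWith L fun p : Euc d × ℝ => V p.1 p.2)
    (hdiv : DivFree d V) {Y X : Euc d → ℝ → Euc d} (hY0 : ∀ x, Y x 0 = x)
    (hY : ∀ x, ∀ t : ℝ, 0 ≤ t → HasDerivWithinAt (Y x) (V (Y x t) t) (Ici 0) t)
    {T : ℝ} (hT : 0 ≤ T) (hXY : ∀ x, X (Y x T) T = x) (hYX : ∀ x, Y (X x T) T = x) :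
    MeasurePreserving (fun x => X x T) := by
  obtain ⟨hYm, hYle⟩ := measurable_and_map_volume_le_of_flow hT hbdd hlip
    (fun t ht => hdiv t ht.1) hY0
    (fun x t ht => (hY x t ht.1).mono Icc_subset_Ici_self)
  obtain ⟨hXm, hXle⟩ := measurable_and_map_volume_le_of_flow (W := fun x s => -V x (T - s))
    (Z := fun x s => Y (X x T) (T - s)) (L := L) (C := C) hT (by simpa using fun x t => hbdd x (T - t))
    (by
      refine LipschitzWith.of_dist_le_mul fun p q => ?_
      rw [dist_neg_neg]
      refine (hlip.dist_le_mul (p.1, T - p.2) (q.1, T - q.2)).trans (le_of_eq ?_)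
      rw [Prod.dist_eq, Prod.dist_eq, dist_sub_left])
    (fun t ht ψ hψ hψc => by
      have := hdiv (T - t) (sub_nonneg.2 ht.2) ψ hψ hψc
      simp [integral_neg, this])
    (fun x => by simp [hYX])
    (fun x t ht => by
      have h1 := (hY (X x T) (T - t) (sub_nonneg.2 ht.2)).scomp (s := Icc 0 T) t
        ((hasDerivWithinAt_id t (Icc 0 T)).const_sub T) (fun s hs => sub_nonneg.2 hs.2)
      simp only [neg_smul, one_smul] at h1
      exact h1)
  simp only [sub_self, hY0] at hXm hXle
  refine ⟨hXm, le_antisymm hXle ?_⟩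
  calc (volume : Measure (Euc d))
      = ((volume : Measure (Euc d)).map fun x => Y x T).map fun x => X x T := by
        rw [Measure.map_map hXm hYm]
        have : (fun x => X x T) ∘ (fun x => Y x T) = id := funext hXY
        rw [this, Measure.map_id]
    _ ≤ _ := Measure.map_mono hYle hXm

namespace Mesh

variable {d : ℕ} {cells : Set (Set (Euc d))} {nrm : Set (Euc d) → Set (Euc d) → Euc d} {h α : ℝ}

lemma hausdorffMeasure_frontier_lt_top (hm : Mesh d cells nrm h α) {K : Set (Euc d)}
    (hK : K ∈ cells) : μH[(d : ℝ) - 1] (frontier K) < ⊤ :=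
  (hm.perimeter_ub K hK).trans_lt ENNReal.ofReal_lt_top

lemma volume_frontier (hm : Mesh d cells nrm h α) {K : Set (Euc d)} (hK : K ∈ cells) :
    volume (frontier K) = 0 := by
  have h1 : μH[(d : ℝ)] (frontier K) = 0 :=
    (hausdorffMeasure_zero_or_top (show (d : ℝ) - 1 < d by linarith) (frontier K)).resolve_right
      (hm.hausdorffMeasure_frontier_lt_top hK).ne
  rw [isAddLeftInvariant_eq_smul (volume : Measure (Euc d)) μH[(Module.finrank ℝ (Euc d) : ℝ)]]
  simp [h1]

lemma volume_toReal_pos (hm : Mesh d cells nrm h α) {K : Set (Euc d)} (hK : K ∈ cells) :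
    0 < (volume K).toReal :=
  (mul_pos hm.α_pos (pow_pos hm.h_pos d)).trans_le (hm.volume_lb K hK)

lemma volume_ne_top (hm : Mesh d cells nrm h α) {K : Set (Euc d)} (hK : K ∈ cells) :
    volume K ≠ ⊤ := fun h0 => by simpa [h0] using hm.volume_toReal_pos hK

lemma interior_ae_eq (hm : Mesh d cells nrm h α) {K : Set (Euc d)} (hK : K ∈ cells) :
    interior K =ᵐ[volume] K := interior_ae_eq_of_null_frontier (hm.volume_frontier hK)

lemma pairwise_disjoint_interior (hm : Mesh d cells nrm h α) :
    Pairwise (Function.onFun Disjoint fun K : cells => interior (K : Set (Euc d))) :=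
  fun K L hKL => disjoint_iff_inter_eq_empty.2 <|
    hm.disjoint_interiors K K.2 L L.2 fun h0 => hKL (Subtype.ext h0)

lemma countable_cells (hm : Mesh d cells nrm h α) : Countable cells := by
  have h1 : (univ : Set cells).Countable := by
    refine Set.PairwiseDisjoint.countable_of_isOpen
      (s := fun K : cells => interior (K : Set (Euc d)))
      (fun K _ L _ hKL => hm.pairwise_disjoint_interior hKL) (fun _ _ => isOpen_interior)
      fun K _ => ?_
    refine nonempty_of_measure_ne_zero (μ := volume) ?_
    rw [measure_congr (hm.interior_ae_eq K.2)]
    exact fun h0 => by simpa [h0] using hm.volume_toReal_pos K.2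
  exact countable_univ_iff.1 h1

lemma iUnion_interior_ae_eq_univ (hm : Mesh d cells nrm h α) :
    (⋃ K : cells, interior (K : Set (Euc d))) =ᵐ[volume] univ := by
  have := hm.countable_cells
  have h1 : (⋃ K : cells, interior (K : Set (Euc d))) =ᵐ[volume] ⋃ K : cells, (K : Set (Euc d)) :=
    Filter.EventuallyEq.countable_iUnion fun K => hm.interior_ae_eq K.2
  rwa [← sUnion_eq_iUnion, hm.cover] at h1

lemma restrict_iUnion_interior (hm : Mesh d cells nrm h α) :
    (volume : Measure (Euc d)).restrict (⋃ K : cells, interior (K : Set (Euc d))) = volume := by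
  rw [Measure.restrict_congr_set hm.iUnion_interior_ae_eq_univ, Measure.restrict_univ]

lemma lintegral_eq_tsum (hm : Mesh d cells nrm h α) (f : Euc d → ℝ≥0∞) :
    ∫⁻ x, f x = ∑' K : cells, ∫⁻ x in interior (K : Set (Euc d)), f x := by
  have := hm.countable_cells
  rw [← lintegral_iUnion (fun K => isOpen_interior.measurableSet) hm.pairwise_disjoint_interior,
    hm.restrict_iUnion_interior]

lemma hasSum_integral (hm : Mesh d cells nrm h α) {f : Euc d → ℝ} (hf : Integrable f) :
    HasSum (fun K : cells => ∫ x in interior (K : Set (Euc d)), f x) (∫ x, f x) := by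
  have := hm.countable_cells
  have h1 := hasSum_integral_iUnion (f := f) (μ := volume)
    (fun K : cells => (isOpen_interior (s := (K : Set (Euc d)))).measurableSet)
    hm.pairwise_disjoint_interior hf.integrableOn
  rwa [hm.restrict_iUnion_interior] at h1

lemma aestronglyMeasurable_of_interior (hm : Mesh d cells nrm h α) {f : Euc d → ℝ}
    {c : Set (Euc d) → ℝ} (hf : ∀ K ∈ cells, ∀ x ∈ interior K, f x = c K) :
    AEStronglyMeasurable f := by
  have := hm.countable_cells
  rw [← hm.restrict_iUnion_interior, aestronglyMeasurable_iUnion_iff]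
  intro K
  refine (aestronglyMeasurable_const (b := c K)).congr ?_
  filter_upwards [ae_restrict_mem isOpen_interior.measurableSet] with x hx
  exact (hf K K.2 x hx).symm

lemma ae_of_interior (hm : Mesh d cells nrm h α) {p : Euc d → Prop}
    (hp : ∀ K ∈ cells, ∀ x ∈ interior K, p x) : ∀ᵐ x, p x := by
  filter_upwards [hm.iUnion_interior_ae_eq_univ.mem_iff] with x hx
  obtain ⟨K, hK⟩ := mem_iUnion.1 (hx.2 trivial)
  exact hp K K.2 x hK

lemma lintegral_ofReal_of_interior (hm : Mesh d cells nrm h α) {f : Euc d → ℝ}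
    {c : Set (Euc d) → ℝ} (hf : ∀ K ∈ cells, ∀ x ∈ interior K, f x = c K) :
    ∫⁻ x, ENNReal.ofReal (f x) = ∑' K : cells, volume (K : Set (Euc d)) * ENNReal.ofReal (c K) := by
  rw [hm.lintegral_eq_tsum]
  refine tsum_congr fun K => ?_
  rw [setLIntegral_congr_fun isOpen_interior.measurableSet
    (g := fun _ => ENNReal.ofReal (c K)) fun x hx => by simp only [hf K K.2 x hx],
    setLIntegral_const, measure_congr (hm.interior_ae_eq K.2), mul_comm]

lemma integrable_of_interior (hm : Mesh d cells nrm h α) {f : Euc d → ℝ}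
    {c : Set (Euc d) → ℝ} (hf : ∀ K ∈ cells, ∀ x ∈ interior K, f x = c K)
    (hc : ∀ K ∈ cells, 0 ≤ c K)
    (hsum : ∑' K : cells, volume (K : Set (Euc d)) * ENNReal.ofReal (c K) ≠ ⊤) :
    Integrable f := by
  refine ⟨hm.aestronglyMeasurable_of_interior hf, ?_⟩
  rw [hasFiniteIntegral_iff_ofReal (hm.ae_of_interior fun K hK x hx => by
    simpa [hf K hK x hx] using hc K hK), hm.lintegral_ofReal_of_interior hf]
  exact hsum.lt_top

lemma abs_flux_le (hm : Mesh d cells nrm h α) {V : Euc d → ℝ → Euc d} {C : ℝ}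
    (hV : ∀ x t, ‖V x t‖ ≤ C) {δt : ℝ} (hδt : 0 < δt) {K L : Set (Euc d)} (hK : K ∈ cells)
    (hL : L ∈ nbr d cells K) (n : ℕ) :
    |flux d V nrm δt K L n| ≤ C * (μH[(d : ℝ) - 1] (K ∩ L)).toReal := by
  have hKL : K ≠ L := hL.2.1.symm
  have hC : 0 ≤ C := (norm_nonneg _).trans (hV 0 0)
  have hfin : μH[(d : ℝ) - 1] (K ∩ L) < ⊤ :=
    (measure_mono (hm.interface_subset_frontier K hK L hL.1 hKL)).trans_lt
      (hm.hausdorffMeasure_frontier_lt_top hK)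
  rw [← Real.norm_eq_abs, flux]
  refine norm_setIntegral_le_of_norm_le_const hfin fun x _ => ?_
  refine (norm_inner_le_norm _ _).trans ?_
  rw [hm.nrm_unit K hK L hL.1 hKL hL.2.2, mul_one, norm_smul, norm_inv, Real.norm_of_nonneg hδt.le]
  have h1 := intervalIntegral.norm_integral_le_of_norm_le_const (f := V x)
    (a := (n : ℝ) * δt) (b := ((n : ℝ) + 1) * δt) (C := C) fun s _ => hV x s
  have h2 : ((n : ℝ) + 1) * δt - n * δt = δt := by ring
  rw [h2, abs_of_pos hδt] at h1
  rw [inv_mul_le_iff₀ hδt]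
  linarith

lemma tsum_interface_le (hm : Mesh d cells nrm h α) {L : Set (Euc d)} (hL : L ∈ cells) :
    ∑' K : cells, (nbr d cells L).indicator (fun K => μH[(d : ℝ) - 1] (L ∩ K)) (K : Set (Euc d)) ≤
      μH[(d : ℝ) - 1] (frontier L) := by
  classical
  have := hm.countable_cells
  let s : cells → Set (Euc d) := fun K => if (K : Set (Euc d)) ∈ nbr d cells L then L ∩ K else ∅
  have hs (K : cells) : (nbr d cells L).indicator (fun K => μH[(d : ℝ) - 1] (L ∩ K))
      (K : Set (Euc d)) = μH[(d : ℝ) - 1] (s K) := by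
    by_cases hK : (K : Set (Euc d)) ∈ nbr d cells L <;> simp [s, hK]
  simp_rw [hs]
  rw [← measure_iUnion₀]
  · refine measure_mono (iUnion_subset fun K => ?_)
    by_cases hK : (K : Set (Euc d)) ∈ nbr d cells L
    · simp only [s, hK, if_true]
      exact hm.interface_subset_frontier L hL K K.2 hK.2.1.symm
    · simp [s, hK]
  · intro K M hKM
    by_cases hK : (K : Set (Euc d)) ∈ nbr d cells L
    · by_cases hM : (M : Set (Euc d)) ∈ nbr d cells L
      · simp only [Function.onFun, s, hK, hM, if_true, AEDisjoint]
        refine measure_mono_null ?_ (hm.interfaces_ae_disjoint L hL K K.2 M M.2 hK.2.1.symm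
          hM.2.1.symm fun h0 => hKM (Subtype.ext h0))
        rintro x ⟨⟨h1, h2⟩, -, h3⟩
        exact ⟨⟨h1, h2⟩, h3⟩
      · simp [Function.onFun, s, hM, AEDisjoint]
    · simp [Function.onFun, s, hK, AEDisjoint]
  · intro K
    refine MeasurableSet.nullMeasurableSet ?_
    by_cases hK : (K : Set (Euc d)) ∈ nbr d cells L
    · simp only [s, hK, if_true]
      exact (hm.closed L hL).measurableSet.inter (hm.closed K K.2).measurableSet
    · simp [s, hK]

/-- The total outflow of a cell is controlled by its volume. -/
lemma exists_tsum_flux_le (hm : Mesh d cells nrm h α) {V : Euc d → ℝ → Euc d} {C : ℝ}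
    (hV : ∀ x t, ‖V x t‖ ≤ C) {δt : ℝ} (hδt : 0 < δt) :
    ∃ c : ℝ≥0∞, c ≠ ⊤ ∧ ∀ L ∈ cells, ∀ n : ℕ,
      ∑' K : cells, (negnbr d cells V nrm δt K n).indicator
        (fun L => ENNReal.ofReal (δt * |flux d V nrm δt K L n|)) L ≤ c * volume L := by
  have hC : 0 ≤ C := (norm_nonneg _).trans (hV 0 0)
  have hvol : 0 < α * h ^ d := mul_pos hm.α_pos (pow_pos hm.h_pos d)
  set P := α⁻¹ * h ^ (d - 1)
  refine ⟨ENNReal.ofReal (δt * C * P / (α * h ^ d)), ENNReal.ofReal_ne_top, fun L hL n => ?_⟩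
  have hP : 0 ≤ P := mul_nonneg (inv_nonneg.2 hm.α_pos.le) (pow_nonneg hm.h_pos.le _)
  calc _ ≤ ∑' K : cells, ENNReal.ofReal (δt * C) *
          (nbr d cells L).indicator (fun K => μH[(d : ℝ) - 1] (L ∩ K)) (K : Set (Euc d)) := by
        refine ENNReal.tsum_le_tsum fun K => ?_
        by_cases hLK : L ∈ negnbr d cells V nrm δt K n
        · have hKL : (K : Set (Euc d)) ∈ nbr d cells L :=
            ⟨K.2, hLK.1.2.1.symm, by rw [inter_comm]; exact hLK.1.2.2⟩
          rw [indicator_of_mem hLK, indicator_of_mem hKL]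
          have hfin : μH[(d : ℝ) - 1] (L ∩ K) ≠ ⊤ :=
            ((measure_mono (hm.interface_subset_frontier L hL K K.2 hKL.2.1.symm)).trans_lt
              (hm.hausdorffMeasure_frontier_lt_top hL)).ne
          rw [← ENNReal.ofReal_toReal hfin, ← ENNReal.ofReal_mul (by positivity), mul_assoc]
          refine ENNReal.ofReal_le_ofReal ?_
          gcongr
          rw [inter_comm]
          exact hm.abs_flux_le hV hδt K.2 hLK.1 n
        · rw [indicator_of_notMem hLK]
          exact zero_le
    _ ≤ ENNReal.ofReal (δt * C) * ENNReal.ofReal P := by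
        rw [ENNReal.tsum_mul_left]
        gcongr
        exact (hm.tsum_interface_le hL).trans (hm.perimeter_ub L hL)
    _ ≤ ENNReal.ofReal (δt * C * P / (α * h ^ d)) * volume L := by
        rw [← ENNReal.ofReal_mul (by positivity), ← ENNReal.ofReal_toReal (hm.volume_ne_top hL),
          ← ENNReal.ofReal_mul (by positivity)]
        refine ENNReal.ofReal_le_ofReal ?_
        rw [div_mul_eq_mul_div, le_div_iff₀ hvol]
        have := hm.volume_lb L hL
        gcongr

end Mesh

section Scheme

variable {d : ℕ} {cells : Set (Set (Euc d))} {nrm : Set (Euc d) → Set (Euc d) → Euc d} {h α : ℝ}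
  {V : Euc d → ℝ → Euc d} {δt ξ : ℝ} {u0 : Euc d → ℝ} {uK : ℕ → Set (Euc d) → ℝ}

lemma Mesh.finite_negnbr (hm : Mesh d cells nrm h α) {K : Set (Euc d)} (hK : K ∈ cells) (n : ℕ) :
    (negnbr d cells V nrm δt K n).Finite :=
  (hm.neighbours_finite K hK).subset fun _ hL => hL.1

lemma IsScheme.volume_mul_succ (hs : IsScheme d cells V nrm δt u0 uK)
    (hm : Mesh d cells nrm h α) {K : Set (Euc d)} (hK : K ∈ cells) (n : ℕ) :
    (volume K).toReal * uK (n + 1) K = (volume K).toReal * uK n K +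
      ∑ L ∈ (hm.finite_negnbr (V := V) (δt := δt) hK n).toFinset,
        δt * |flux d V nrm δt K L n| * (uK n L - uK n K) := by
  have hv := hm.volume_toReal_pos hK
  rw [hs.2 n K hK, finsum_mem_eq_finite_toFinset_sum _ (hm.finite_negnbr hK n), mul_sub,
    sub_eq_add_neg, ← mul_assoc, mul_div_cancel₀ _ hv.ne', Finset.mul_sum, ← Finset.sum_neg_distrib]
  congr 1
  refine Finset.sum_congr rfl fun L hL => ?_
  rw [abs_of_neg ((Set.Finite.mem_toFinset _).1 hL).2]
  ring

/-- Discrete maximum principle. -/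
lemma IsScheme.mem_Icc (hs : IsScheme d cells V nrm δt u0 uK) (hm : Mesh d cells nrm h α)
    (hδt : 0 < δt) (hξ : 0 ≤ ξ) (hcfl : CFL d cells V nrm δt ξ) (hint : Integrable u0)
    (hu0 : ∀ᵐ x : Euc d, u0 x ∈ Icc (0 : ℝ) 1) (n : ℕ) :
    ∀ K ∈ cells, uK n K ∈ Icc (0 : ℝ) 1 := by
  induction n with
  | zero =>
    intro K hK
    have hv := hm.volume_toReal_pos hK
    rw [hs.1 K hK]
    have h0 : 0 ≤ ∫ x in K, u0 x :=
      integral_nonneg_of_ae (ae_restrict_of_ae (hu0.mono fun x hx => hx.1))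
    refine ⟨by positivity, ?_⟩
    rw [inv_mul_le_iff₀ hv]
    calc ∫ x in K, u0 x ≤ ∫ _ in K, (1 : ℝ) :=
          integral_mono_ae hint.integrableOn (integrableOn_const (hm.volume_ne_top hK))
            (ae_restrict_of_ae (hu0.mono fun x hx => hx.2))
      _ = (volume K).toReal * 1 := by simp [Measure.real]
  | succ n ih =>
    intro K hK
    have hv := hm.volume_toReal_pos hK
    have hcK := hcfl K hK n
    rw [finsum_mem_eq_finite_toFinset_sum _ (hm.finite_negnbr hK n)] at hcK
    have hrec := hs.volume_mul_succ hm hK n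
    set F := (hm.finite_negnbr (V := V) (δt := δt) hK n).toFinset
    obtain ⟨hu0, hu1⟩ := ih K hK
    have hF : ∀ L ∈ F, L ∈ cells := fun L hL => ((Set.Finite.mem_toFinset _).1 hL).1.1
    have hS0 : 0 ≤ ∑ L ∈ F, δt * |flux d V nrm δt K L n| :=
      Finset.sum_nonneg fun L _ => by positivity
    have hS : ∑ L ∈ F, δt * |flux d V nrm δt K L n| ≤ (volume K).toReal :=
      hcK.trans (by nlinarith)
    have hlow : (∑ L ∈ F, δt * |flux d V nrm δt K L n|) * (0 - uK n K) ≤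
        ∑ L ∈ F, δt * |flux d V nrm δt K L n| * (uK n L - uK n K) := by
      rw [Finset.sum_mul]
      refine Finset.sum_le_sum fun L hL => ?_
      have := (ih L (hF L hL)).1
      gcongr
    have hupp : ∑ L ∈ F, δt * |flux d V nrm δt K L n| * (uK n L - uK n K) ≤
        (∑ L ∈ F, δt * |flux d V nrm δt K L n|) * (1 - uK n K) := by
      rw [Finset.sum_mul]
      refine Finset.sum_le_sum fun L hL => ?_
      have := (ih L (hF L hL)).2
      gcongr
    constructor
    · refine nonneg_of_mul_nonneg_right (a := (volume K).toReal) ?_ hv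
      nlinarith
    · refine le_of_mul_le_mul_left (a := (volume K).toReal) ?_ hv
      nlinarith

lemma IsScheme.tsum_volume_mul_ne_top (hs : IsScheme d cells V nrm δt u0 uK)
    (hm : Mesh d cells nrm h α) {C : ℝ} (hV : ∀ x t, ‖V x t‖ ≤ C) (hδt : 0 < δt) (hξ : 0 ≤ ξ)
    (hcfl : CFL d cells V nrm δt ξ) (hint : Integrable u0)
    (hu0 : ∀ᵐ x : Euc d, u0 x ∈ Icc (0 : ℝ) 1) (n : ℕ) :
    ∑' K : cells, volume (K : Set (Euc d)) * ENNReal.ofReal (uK n K) ≠ ⊤ := by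
  have hbd := hs.mem_Icc hm hδt hξ hcfl hint hu0
  induction n with
  | zero =>
    have h1 : ∑' K : cells, volume (K : Set (Euc d)) * ENNReal.ofReal (uK 0 K) =
        ∫⁻ x, ENNReal.ofReal (u0 x) := by
      rw [hm.lintegral_eq_tsum]
      refine tsum_congr fun K => ?_
      rw [← ofReal_integral_eq_lintegral_ofReal hint.integrableOn
          (ae_restrict_of_ae (hu0.mono fun x hx => hx.1)),
        setIntegral_congr_set (hm.interior_ae_eq K.2), hs.1 K K.2]
      nth_rw 1 [← ENNReal.ofReal_toReal (hm.volume_ne_top K.2)]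
      rw [← ENNReal.ofReal_mul (by positivity),
        mul_inv_cancel_left₀ (hm.volume_toReal_pos K.2).ne']
    rw [h1]
    exact hint.lintegral_lt_top.ne
  | succ n ih =>
    obtain ⟨c, hc, hflux⟩ := hm.exists_tsum_flux_le hV hδt
    let a : Set (Euc d) → Set (Euc d) → ℝ≥0∞ := fun K =>
      (negnbr d cells V nrm δt K n).indicator
        fun L => ENNReal.ofReal (δt * |flux d V nrm δt K L n|)
    have hstep (K : cells) : volume (K : Set (Euc d)) * ENNReal.ofReal (uK (n + 1) K) ≤
        volume (K : Set (Euc d)) * ENNReal.ofReal (uK n K) +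
          ∑' L : cells, a K L * ENNReal.ofReal (uK n L) := by
      classical
      have hrec := hs.volume_mul_succ hm K.2 n
      set F := (hm.finite_negnbr (V := V) (δt := δt) K.2 n).toFinset
      have hF : ∀ L ∈ F, L ∈ cells := fun L hL => ((Set.Finite.mem_toFinset _).1 hL).1.1
      have hsum : ENNReal.ofReal (∑ L ∈ F, δt * |flux d V nrm δt K L n| * uK n L) ≤
          ∑' L : cells, a K L * ENNReal.ofReal (uK n L) := by
        rw [ENNReal.ofReal_sum_of_nonneg fun L hL =>
          mul_nonneg (by positivity) (hbd n L (hF L hL)).1]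
        calc _ = ∑ L ∈ F, a K L * ENNReal.ofReal (uK n L) := by
              refine Finset.sum_congr rfl fun L hL => ?_
              simp only [a]
              rw [indicator_of_mem ((Set.Finite.mem_toFinset _).1 hL),
                ENNReal.ofReal_mul (by positivity)]
          _ = ∑ L ∈ F.subtype (· ∈ cells), a K L * ENNReal.ofReal (uK n L) :=
              (Finset.sum_subtype_of_mem (fun L => a K L * ENNReal.ofReal (uK n L)) hF).symm
          _ ≤ _ := ENNReal.sum_le_tsum _
      refine le_trans ?_ (add_le_add_right hsum _)
      rw [← ENNReal.ofReal_toReal (hm.volume_ne_top K.2), ← ENNReal.ofReal_mul (by positivity),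
        ← ENNReal.ofReal_mul (by positivity), ← ENNReal.ofReal_add
          (mul_nonneg (by positivity) (hbd n K K.2).1)
          (Finset.sum_nonneg fun L hL => mul_nonneg (by positivity) (hbd n L (hF L hL)).1), hrec]
      refine ENNReal.ofReal_le_ofReal ?_
      gcongr with L hL
      linarith [(hbd n K K.2).1]
    refine ne_top_of_le_ne_top ?_ (ENNReal.tsum_le_tsum hstep)
    rw [ENNReal.tsum_add, ENNReal.tsum_comm]
    refine ENNReal.add_ne_top.2 ⟨ih, ne_top_of_le_ne_top (ENNReal.mul_ne_top hc ih) ?_⟩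
    rw [← ENNReal.tsum_mul_left]
    refine ENNReal.tsum_le_tsum fun L => ?_
    rw [ENNReal.tsum_mul_right, ← mul_assoc]
    gcongr
    exact hflux L L.2 n

end Scheme

lemma integrable_sq_of_mem_Icc {d : ℕ} {f : Euc d → ℝ} (hf : Integrable f)
    (h01 : ∀ᵐ x, f x ∈ Icc (0 : ℝ) 1) : Integrable fun x => f x ^ 2 := by
  refine hf.mono (hf.aestronglyMeasurable.pow 2) ?_
  filter_upwards [h01] with x hx
  rw [Real.norm_of_nonneg (by positivity), Real.norm_of_nonneg hx.1]
  nlinarith [hx.1, hx.2]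

/-- Averaging over cells decreases the `L²` norm. -/
lemma Mesh.integral_sq_average_le {d : ℕ} {cells : Set (Set (Euc d))}
    {nrm : Set (Euc d) → Set (Euc d) → Euc d} {h α : ℝ} (hm : Mesh d cells nrm h α)
    {f g : Euc d → ℝ} (hf : Integrable f) (hf2 : Integrable fun x => f x ^ 2)
    (hg2 : Integrable fun x => g x ^ 2)
    (hgf : ∀ K ∈ cells, ∀ x ∈ interior K, g x = ((volume K).toReal)⁻¹ * ∫ y in K, f y) :
    ∫ x, g x ^ 2 ≤ ∫ x, f x ^ 2 := by
  refine hasSum_le (fun K => ?_) (hm.hasSum_integral hg2) (hm.hasSum_integral hf2)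
  have hv := hm.volume_toReal_pos K.2
  set c := ((volume (K : Set (Euc d))).toReal)⁻¹ * ∫ y in (K : Set (Euc d)), f y with hc
  have hcv : ∫ y in interior (K : Set (Euc d)), f y = (volume (K : Set (Euc d))).toReal * c := by
    rw [setIntegral_congr_set (hm.interior_ae_eq K.2), hc, mul_inv_cancel_left₀ hv.ne']
  have hvI : volume (interior (K : Set (Euc d))) = volume (K : Set (Euc d)) :=
    measure_congr (hm.interior_ae_eq K.2)
  have hconst (r : ℝ) : ∫ _ in interior (K : Set (Euc d)), r =
      (volume (K : Set (Euc d))).toReal * r := by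
    rw [setIntegral_const, Measure.real, hvI, smul_eq_mul]
  have hconst_int (r : ℝ) : IntegrableOn (fun _ => r) (interior (K : Set (Euc d))) :=
    integrableOn_const (hvI ▸ hm.volume_ne_top K.2)
  calc ∫ x in interior (K : Set (Euc d)), g x ^ 2
      = ∫ x in interior (K : Set (Euc d)), c ^ 2 :=
        setIntegral_congr_fun isOpen_interior.measurableSet fun x hx => by
          simp only [hgf K K.2 x hx, c]
    _ = ∫ x in interior (K : Set (Euc d)), (2 * c * f x - c ^ 2) := by
        rw [integral_sub (hf.integrableOn.const_mul _) (hconst_int _), integral_const_mul, hcv,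
          hconst]
        ring
    _ ≤ ∫ x in interior (K : Set (Euc d)), f x ^ 2 :=
        integral_mono ((hf.integrableOn.const_mul _).sub (hconst_int _)) hf2.integrableOn
          fun x => by
            change 2 * c * f x - c ^ 2 ≤ f x ^ 2
            nlinarith [sq_nonneg (f x - c)]

/-- **The L¹ error controls the energy jump** (Lemma 5.1): under the CFL condition, for
an initial datum `u0 ∈ L¹` with `0 ≤ u0 ≤ 1` a.e. and `t = (N+1)δt`,
`𝓔_h(u0,t) = ‖u_h(·,0)‖_{L²}² − ‖u_h(·,t)‖_{L²}² ≤ 2 ‖u_h(·,t) − u(·,t)‖_{L¹}`, where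
`u(x,t) = u0(X(x,t))` is the exact solution. -/
theorem energy_jump_le_L1_error (d : ℕ) (hd : 1 ≤ d)
    (V : Euc d → ℝ → Euc d) (CV : ℝ) (LV : ℝ≥0)
    (hVbdd : ∀ x t, ‖V x t‖ ≤ CV)
    (hVlip : LipschitzWith LV (fun p : Euc d × ℝ => V p.1 p.2))
    (hVdiv : DivFree d V)
    (Y X : Euc d → ℝ → Euc d)
    (hY0 : ∀ x, Y x 0 = x)
    (hYderiv : ∀ x, ∀ t : ℝ, 0 ≤ t → HasDerivWithinAt (Y x) (V (Y x t) t) (Ici 0) t)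
    (hXY : ∀ t : ℝ, 0 ≤ t → ∀ x, X (Y x t) t = x)
    (hYX : ∀ t : ℝ, 0 ≤ t → ∀ x, Y (X x t) t = x)
    (cells : Set (Set (Euc d))) (nrm : Set (Euc d) → Set (Euc d) → Euc d) (h α : ℝ)
    (hmesh : Mesh d cells nrm h α)
    (δt : ℝ) (hδt : 0 < δt)
    (ξ : ℝ) (hξ : ξ ∈ Ico (0 : ℝ) 1)
    (hcfl : CFL d cells V nrm δt ξ)
    (u0 : Euc d → ℝ) (hu0L1 : Integrable u0)
    (hu0ub : ∀ᵐ x : Euc d, u0 x ∈ Icc (0 : ℝ) 1)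
    (uK : ℕ → Set (Euc d) → ℝ) (hscheme : IsScheme d cells V nrm δt u0 uK)
    (uh : Euc d → ℝ → ℝ) (huh : IsUh d cells δt uK uh)
    (N : ℕ) :
    (∫ x : Euc d, (uh x 0) ^ 2) - (∫ x : Euc d, (uh x (((N : ℝ) + 1) * δt)) ^ 2) ≤
      2 * ∫ x : Euc d,
        |uh x (((N : ℝ) + 1) * δt) - u0 (X x (((N : ℝ) + 1) * δt))| := by
  obtain ⟨hξ0, -⟩ := hξ
  set T := ((N : ℝ) + 1) * δt
  have hT : 0 ≤ T := by positivity
  have hX := measurePreserving_flow_inverse hVbdd hVlip hVdiv hY0 hYderiv hT (hXY T hT) (hYX T hT)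
  have hval (n : ℕ) : ∀ K ∈ cells, ∀ x ∈ interior K, uh x (n * δt) = uK n K := fun K hK x hx =>
    huh n K hK x hx _ ⟨le_rfl, by nlinarith⟩
  have hbd := hscheme.mem_Icc hmesh hδt hξ0 hcfl hu0L1 hu0ub
  have hint (n : ℕ) : Integrable fun x => uh x (n * δt) :=
    hmesh.integrable_of_interior (hval n) (fun K hK => (hbd n K hK).1)
      (hscheme.tsum_volume_mul_ne_top hmesh hVbdd hδt hξ0 hcfl hu0L1 hu0ub n)
  have hIcc (n : ℕ) : ∀ᵐ x, uh x (n * δt) ∈ Icc (0 : ℝ) 1 :=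
    hmesh.ae_of_interior fun K hK x hx => by rw [hval n K hK x hx]; exact hbd n K hK
  have hN : ((N + 1 : ℕ) : ℝ) * δt = T := by push_cast; rfl
  have hintT := hint (N + 1)
  have hIccT := hIcc (N + 1)
  have hint0 := hint 0
  have hIcc0 := hIcc 0
  have hval0 := hval 0
  rw [hN] at hIccT
  simp only [hN] at hintT
  simp only [Nat.cast_zero, zero_mul] at hint0 hIcc0 hval0
  have hu0sq := integrable_sq_of_mem_Icc hu0L1 hu0ub
  have hu : Integrable fun x => u0 (X x T) := hX.integrable_comp_of_integrable hu0L1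
  have huIcc : ∀ᵐ x, u0 (X x T) ∈ Icc (0 : ℝ) 1 := hX.quasiMeasurePreserving.ae hu0ub
  have husq : ∫ x, u0 (X x T) ^ 2 = ∫ x, u0 x ^ 2 := by
    have h1 := integral_map (μ := volume) (φ := fun x => X x T) (f := fun x => u0 x ^ 2)
      hX.measurable.aemeasurable (by rw [hX.map_eq]; exact hu0sq.aestronglyMeasurable)
    rw [hX.map_eq] at h1
    exact h1.symm
  have hproj : ∫ x, uh x 0 ^ 2 ≤ ∫ x, u0 x ^ 2 :=
    hmesh.integral_sq_average_le hu0L1 hu0sq (integrable_sq_of_mem_Icc hint0 hIcc0)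
      fun K hK x hx => by rw [hval0 K hK x hx, hscheme.1 K hK]
  calc (∫ x, uh x 0 ^ 2) - ∫ x, uh x T ^ 2
      ≤ (∫ x, u0 (X x T) ^ 2) - ∫ x, uh x T ^ 2 := by rw [husq]; gcongr
    _ = ∫ x, (u0 (X x T) ^ 2 - uh x T ^ 2) :=
        (integral_sub (integrable_sq_of_mem_Icc hu huIcc)
          (integrable_sq_of_mem_Icc hintT hIccT)).symm
    _ ≤ ∫ x, 2 * |uh x T - u0 (X x T)| := by
        refine integral_mono_ae ((integrable_sq_of_mem_Icc hu huIcc).sub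
          (integrable_sq_of_mem_Icc hintT hIccT)) ((hintT.sub hu).abs.const_mul 2) ?_
        filter_upwards [huIcc, hIccT] with x ⟨h1, h2⟩ ⟨h3, h4⟩
        have h5 := neg_abs_le (uh x T - u0 (X x T))
        have h6 := abs_nonneg (uh x T - u0 (X x T))
        change u0 (X x T) ^ 2 - uh x T ^ 2 ≤ 2 * |uh x T - u0 (X x T)|
        nlinarith
    _ = 2 * ∫ x, |uh x T - u0 (X x T)| := integral_const_mul _ _
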